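/- Let 𝔽 = (f_{n,m})_{n,m∈ℕ} be a Hermitian matrix with Σ_{n,m}|f_{n,m}|² < ∞, regarded as a self-adjoint Hilbert–Schmidt operator on ℓ²(ℕ), with N×N truncations 𝔽^{(N)}, whose positive eigenvalues with multiplicity in decreasing order are μ_j^{(N)} (j = 1,…,N₊) and negative ones in increasing order μ_{−j}^{(N)} (j = 1,…,N₋). Fix j ≥ 1 and suppose some truncation has at least j positive eigenvalues. Then 𝔽 has at least j positive eigenvalues (with multiplicity), listed in decreasing order μ₁ ≥ μ₂ ≥ …, and μ_j^{(N)} ↗ μ_j as N → ∞. Similarly, if some truncation has at least j negative eigenvalues, then 𝔽 has a j-th negative eigenvalue μ_{−j} (negative eigenvalues listed in increasing order) and μ_{−j}^{(N)} ↘ μ_{−j} as N → ∞. -/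

import Mathlib

open Filter

/-- `IsJthPosEig T j L` : `L` is the `j`-th largest positive eigenvalue (counted with
multiplicity, `1`-indexed) of the endomorphism `T`. -/
def IsJthPosEig {V : Type*} [AddCommGroup V] [Module ℂ V]
    (T : V →ₗ[ℂ] V) (j : ℕ) (L : ℝ) : Prop :=
  0 < L ∧
  (j : Cardinal) ≤ Module.rank ℂ
      ↥(⨆ s : {s : ℝ // L ≤ s}, Module.End.eigenspace T ((s : ℝ) : ℂ)) ∧
  ∀ t : ℝ, L < t →
    Module.rank ℂ ↥(⨆ s : {s : ℝ // t ≤ s}, Module.End.eigenspace T ((s : ℝ) : ℂ)) <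
      (j : Cardinal)

/-- `IsJthNegEig T j L` : `L` is the `j`-th smallest negative eigenvalue (counted with
multiplicity, `1`-indexed, negative eigenvalues listed in increasing order) of `T`. -/
def IsJthNegEig {V : Type*} [AddCommGroup V] [Module ℂ V]
    (T : V →ₗ[ℂ] V) (j : ℕ) (L : ℝ) : Prop :=
  L < 0 ∧
  (j : Cardinal) ≤ Module.rank ℂ
      ↥(⨆ s : {s : ℝ // s ≤ L}, Module.End.eigenspace T ((s : ℝ) : ℂ)) ∧
  ∀ t : ℝ, t < L →
    Module.rank ℂ ↥(⨆ s : {s : ℝ // s ≤ t}, Module.End.eigenspace T ((s : ℝ) : ℂ)) <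
      (j : Cardinal)

open scoped InnerProductSpace

section Abstract

variable {H : Type*} [NormedAddCommGroup H] [InnerProductSpace ℂ H]

/-- Span of the eigenspaces for real eigenvalues at least `t`. -/
def upperSpan {V : Type*} [AddCommGroup V] [Module ℂ V] (S : V →ₗ[ℂ] V) (t : ℝ) :
    Submodule ℂ V :=
  ⨆ s : {s : ℝ // t ≤ s}, Module.End.eigenspace S ((s : ℝ) : ℂ)

lemma upperSpan_anti {V : Type*} [AddCommGroup V] [Module ℂ V] (S : V →ₗ[ℂ] V) {t t' : ℝ}
    (h : t ≤ t') : upperSpan S t' ≤ upperSpan S t := by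
  refine iSup_le fun s => ?_
  exact le_iSup (fun s : {s : ℝ // t ≤ s} => Module.End.eigenspace S ((s : ℝ) : ℂ))
    ⟨s.1, h.trans s.2⟩

/-- There is a `j`-dimensional subspace on which the form of `S` is at least `t`. -/
def FormGe (S : H →L[ℂ] H) (j : ℕ) (t : ℝ) : Prop :=
  ∃ φ : (Fin j → ℂ) →ₗ[ℂ] H, Function.Injective φ ∧
    ∀ c, t * ‖φ c‖ ^ 2 ≤ (⟪S (φ c), φ c⟫_ℂ).re

lemma FormGe.mono {S : H →L[ℂ] H} {j : ℕ} {t t' : ℝ} (h : FormGe S j t') (ht : t ≤ t') :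
    FormGe S j t := by
  obtain ⟨φ, h1, h2⟩ := h
  exact ⟨φ, h1, fun c => le_trans (by gcongr) (h2 c)⟩

lemma FormGe.le_norm {S : H →L[ℂ] H} {j : ℕ} {t : ℝ} (hj : 1 ≤ j) (h : FormGe S j t) :
    t ≤ ‖S‖ := by
  obtain ⟨φ, h1, h2⟩ := h
  have hne : φ (fun _ => 1) ≠ 0 := by
    intro h0
    have := h1 (h0.trans (map_zero φ).symm)
    have := congrFun this ⟨0, hj⟩
    simp at this
  set x := φ (fun _ => 1)
  have h3 : (⟪S x, x⟫_ℂ).re ≤ ‖S‖ * ‖x‖ ^ 2 := by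
    calc (⟪S x, x⟫_ℂ).re ≤ ‖⟪S x, x⟫_ℂ‖ := Complex.re_le_norm _
      _ ≤ ‖S x‖ * ‖x‖ := norm_inner_le_norm _ _
      _ ≤ ‖S‖ * ‖x‖ * ‖x‖ := by gcongr; exact S.le_opNorm x
      _ = _ := by ring
  have hp : 0 < ‖x‖ ^ 2 := by positivity
  exact le_of_mul_le_mul_right ((h2 _).trans h3) hp

variable [CompleteSpace H]

lemma spectral_decomp {S : H →L[ℂ] H} (hc : IsCompactOperator S)
    (hs : (S : H →ₗ[ℂ] H).IsSymmetric) (x : H) :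
    ∃ w : ℂ → H, (∀ μ, S (w μ) = μ • w μ) ∧ (∀ μ, ⟪x, w μ⟫_ℂ = ((‖w μ‖ ^ 2 : ℝ) : ℂ)) ∧
      HasSum w x := by
  have hO := hs.orthogonalFamily_eigenspaces
  have hcl : ∀ μ : ℂ, CompleteSpace (Module.End.eigenspace (S : H →ₗ[ℂ] H) μ) := by
    intro μ
    have : IsClosed ((Module.End.eigenspace (S : H →ₗ[ℂ] H) μ : Submodule ℂ H) : Set H) := by
      have : ((Module.End.eigenspace (S : H →ₗ[ℂ] H) μ : Submodule ℂ H) : Set H)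
          = {y | S y = μ • y} := by
        ext y; simp
      rw [this]
      exact isClosed_eq S.continuous (by fun_prop)
    exact this.completeSpace_coe
  have hV : IsHilbertSum ℂ (fun μ : ℂ => Module.End.eigenspace (S : H →ₗ[ℂ] H) μ)
      (fun μ => (Module.End.eigenspace (S : H →ₗ[ℂ] H) μ).subtypeₗᵢ) := by
    refine IsHilbertSum.mkInternal _ hO ?_
    rw [top_le_iff, Submodule.topologicalClosure_eq_top_iff]
    exact ContinuousLinearMap.orthogonalComplement_iSup_eigenspaces_eq_bot hc hs
  have hsum := hV.hasSum_linearIsometryEquiv_symm (hV.linearIsometryEquiv x)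
  rw [LinearIsometryEquiv.symm_apply_apply] at hsum
  set w := hV.linearIsometryEquiv x
  refine ⟨fun μ => (w μ : H), fun μ => ?_, fun μ => ?_, hsum⟩
  · exact Module.End.mem_eigenspace_iff.1 (w μ).2
  · have h1 : HasSum (fun ν => ⟪(w μ : H), (w ν : H)⟫_ℂ) ⟪(w μ : H), x⟫_ℂ :=
      hsum.mapL (innerSL ℂ (w μ : H))
    have h2 : HasSum (fun ν => ⟪(w μ : H), (w ν : H)⟫_ℂ) ⟪(w μ : H), (w μ : H)⟫_ℂ := by
      refine hasSum_single μ fun ν hν => ?_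
      exact hO hν.symm (w μ) (w ν)
    have h3 := h1.unique h2
    rw [← inner_conj_symm, h3, inner_self_eq_norm_sq_to_K]
    simp

lemma form_hasSum {S : H →L[ℂ] H} {x : H} {w : ℂ → H}
    (hs : (S : H →ₗ[ℂ] H).IsSymmetric)
    (h1 : ∀ μ, S (w μ) = μ • w μ) (h2 : ∀ μ, ⟪x, w μ⟫_ℂ = ((‖w μ‖ ^ 2 : ℝ) : ℂ))
    (h3 : HasSum w x) (t : ℝ) :
    HasSum (fun μ : ℂ => (μ.re - t) * ‖w μ‖ ^ 2) ((⟪S x, x⟫_ℂ).re - t * ‖x‖ ^ 2) := by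
  have a1 : HasSum (fun μ => ⟪x, w μ⟫_ℂ) ⟪x, x⟫_ℂ := h3.mapL (innerSL ℂ x)
  have a2 : HasSum (fun μ => ⟪S x, w μ⟫_ℂ) ⟪S x, x⟫_ℂ := h3.mapL (innerSL ℂ (S x))
  have b1 := Complex.hasSum_re a1
  have b2 := Complex.hasSum_re a2
  have e1 : (⟪x, x⟫_ℂ).re = ‖x‖ ^ 2 := by
    rw [inner_self_eq_norm_sq_to_K]; norm_cast
  rw [e1] at b1
  refine (b2.sub (b1.mul_left t)).congr_fun fun μ => ?_
  have : ⟪S x, w μ⟫_ℂ = μ * ((‖w μ‖ ^ 2 : ℝ) : ℂ) := by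
    have := hs x (w μ)
    simp only [ContinuousLinearMap.coe_coe] at this
    rw [this, h1, inner_smul_right, h2]
  rw [this, h2, Complex.re_mul_ofReal, Complex.ofReal_re]
  ring

lemma form_ge_of_mem {S : H →L[ℂ] H} (hc : IsCompactOperator S)
    (hs : (S : H →ₗ[ℂ] H).IsSymmetric) {t : ℝ} {x : H} (hx : x ∈ upperSpan (S : H →ₗ[ℂ] H) t) :
    t * ‖x‖ ^ 2 ≤ (⟪S x, x⟫_ℂ).re := by
  obtain ⟨w, h1, h2, h3⟩ := spectral_decomp hc hs x
  have := (form_hasSum hs h1 h2 h3 t).nonneg (fun μ => ?_)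
  · linarith
  by_cases hμ : t ≤ μ.re
  · exact mul_nonneg (by linarith) (by positivity)
  · have hle : upperSpan (S : H →ₗ[ℂ] H) t ≤ (Submodule.span ℂ {w μ})ᗮ := by
      refine iSup_le fun s y hy => ?_
      rw [Submodule.mem_orthogonal_singleton_iff_inner_right]
      have hne : μ ≠ ((s : ℝ) : ℂ) := by
        rintro rfl
        exact hμ (by simpa using s.2)
      exact hs.orthogonalFamily_eigenspaces hne
        ⟨w μ, Module.End.mem_eigenspace_iff.2 (h1 μ)⟩ ⟨y, hy⟩
    have h4 := Submodule.mem_orthogonal_singleton_iff_inner_left.1 (hle hx)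
    rw [h2] at h4
    have : ‖w μ‖ ^ 2 = 0 := by exact_mod_cast h4
    simp [this]

lemma eq_zero_of_orthogonal {S : H →L[ℂ] H} (hc : IsCompactOperator S)
    (hs : (S : H →ₗ[ℂ] H).IsSymmetric) {t : ℝ} {x : H}
    (hx : x ∈ (upperSpan (S : H →ₗ[ℂ] H) t)ᗮ)
    (hge : t * ‖x‖ ^ 2 ≤ (⟪S x, x⟫_ℂ).re) : x = 0 := by
  obtain ⟨w, h1, h2, h3⟩ := spectral_decomp hc hs x
  have hsum := form_hasSum hs h1 h2 h3 t
  have hw : ∀ μ : ℂ, w μ ≠ 0 → μ.re < t := by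
    intro μ hμ
    by_contra hlt
    push Not at hlt
    have hE : Module.End.HasEigenvalue (S : H →ₗ[ℂ] H) μ :=
      Module.End.hasEigenvalue_of_hasEigenvector ⟨Module.End.mem_eigenspace_iff.2 (h1 μ), hμ⟩
    have hr : ((μ.re : ℝ) : ℂ) = μ := Complex.conj_eq_iff_re.1 (hs.conj_eigenvalue_eq_self hE)
    have hm : w μ ∈ upperSpan (S : H →ₗ[ℂ] H) t := by
      refine Submodule.mem_iSup_of_mem (⟨μ.re, hlt⟩ : {s : ℝ // t ≤ s}) ?_
      rw [Module.End.mem_eigenspace_iff]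
      simp only [hr]
      exact h1 μ
    have h4 := (Submodule.mem_orthogonal' _ _).1 hx _ hm
    rw [h2] at h4
    have : ‖w μ‖ ^ 2 = 0 := by exact_mod_cast h4
    exact hμ (by simpa using this)
  have hall : ∀ μ, w μ = 0 := by
    intro μ
    by_contra hμ
    have hle := hsum.neg
    have := le_hasSum hle μ (fun ν _ => ?_)
    · have hpos : 0 < ‖w μ‖ ^ 2 := by positivity
      nlinarith [hw μ hμ]
    · by_cases hν : w ν = 0
      · simp [hν]
      · have := hw ν hν
        have : 0 ≤ (t - ν.re) * ‖w ν‖ ^ 2 := mul_nonneg (by linarith) (by positivity)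
        linarith
  have h0 : HasSum w 0 := by
    have : w = fun _ => 0 := funext hall
    rw [this]; exact hasSum_zero
  exact h3.unique h0

lemma le_rank_iff_formGe {S : H →L[ℂ] H} (hc : IsCompactOperator S)
    (hs : (S : H →ₗ[ℂ] H).IsSymmetric) (j : ℕ) (t : ℝ) :
    (j : Cardinal) ≤ Module.rank ℂ (upperSpan (S : H →ₗ[ℂ] H) t) ↔ FormGe S j t := by
  constructor
  · intro h
    obtain ⟨φ, hφ⟩ := Module.le_rank_iff_exists_linearMap.1 h
    refine ⟨(Submodule.subtype _).comp φ, Subtype.val_injective.comp hφ, fun c => ?_⟩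
    exact form_ge_of_mem hc hs (φ c).2
  · rintro ⟨φ, hφ, hge⟩
    by_contra hlt
    push Not at hlt
    have hfin : Module.Finite ℂ (upperSpan (S : H →ₗ[ℂ] H) t) := by
      rw [← Module.rank_lt_aleph0_iff]
      exact hlt.trans (Cardinal.natCast_lt_aleph0)
    set E := upperSpan (S : H →ₗ[ℂ] H) t with hE
    let P : H →ₗ[ℂ] E := (E.orthogonalProjectionOnto : H →L[ℂ] E)
    have hni : ¬ Function.Injective (P.comp φ) := fun hinj =>
      absurd (Module.le_rank_iff_exists_linearMap.2 ⟨_, hinj⟩) (not_le.2 hlt)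
    rw [← LinearMap.ker_eq_bot, LinearMap.ker_eq_bot'] at hni
    push Not at hni
    obtain ⟨c, hc0, hcne⟩ := hni
    have hmem : φ c ∈ Eᗮ := by
      rw [← Submodule.orthogonalProjectionOnto_eq_zero_iff]
      exact hc0
    have := eq_zero_of_orthogonal hc hs hmem (hge c)
    exact hcne (hφ (this.trans (map_zero φ).symm))

lemma isJthPosEig_iff {S : H →L[ℂ] H} (hc : IsCompactOperator S)
    (hs : (S : H →ₗ[ℂ] H).IsSymmetric) (j : ℕ) (L : ℝ) :
    IsJthPosEig (S : H →ₗ[ℂ] H) j L ↔ 0 < L ∧ FormGe S j L ∧ ∀ t, L < t → ¬ FormGe S j t := by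
  unfold IsJthPosEig
  simp only [← le_rank_iff_formGe hc hs, not_le]
  rfl

/-- If the rank of the spectral subspaces stays bounded below `L`, the form condition passes to
the supremum. -/
lemma formGe_sup {S : H →L[ℂ] H} (hc : IsCompactOperator S)
    (hs : (S : H →ₗ[ℂ] H).IsSymmetric) {j N : ℕ} {L a : ℝ} (haL : a < L)
    (hN : ¬ FormGe S (N + 1) a) (h : ∀ t, t < L → FormGe S j t) : FormGe S j L := by
  have hfin : ∀ t, a ≤ t → Module.Finite ℂ (upperSpan (S : H →ₗ[ℂ] H) t) := by
    intro t hat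
    have h1 : ¬ FormGe S (N + 1) t := fun h => hN (h.mono hat)
    rw [← le_rank_iff_formGe hc hs, not_le] at h1
    rw [← Module.rank_lt_aleph0_iff]
    exact h1.trans (Cardinal.natCast_lt_aleph0)
  obtain ⟨t₀, ⟨hat, htL⟩, hmin⟩ : ∃ t₀, (a ≤ t₀ ∧ t₀ < L) ∧ ∀ t, a ≤ t ∧ t < L →
      Module.finrank ℂ (upperSpan (S : H →ₗ[ℂ] H) t₀) ≤
        Module.finrank ℂ (upperSpan (S : H →ₗ[ℂ] H) t) := by
    have hne : (Set.Ico a L).Nonempty := ⟨a, le_refl _, haL⟩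
    obtain ⟨m, hm, hmin⟩ := WellFounded.has_min
      (InvImage.wf (fun t => Module.finrank ℂ (upperSpan (S : H →ₗ[ℂ] H) t)) Nat.lt_wfRel.wf)
      (Set.Ico a L) hne
    exact ⟨m, hm, fun t ht => not_lt.1 (hmin t ht)⟩
  have heq : ∀ t, t₀ ≤ t → t < L → upperSpan (S : H →ₗ[ℂ] H) t = upperSpan (S : H →ₗ[ℂ] H) t₀ := by
    intro t h1 h2
    have := hfin t₀ hat
    exact Submodule.eq_of_le_of_finrank_le (upperSpan_anti _ h1) (hmin t ⟨hat.trans h1, h2⟩)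
  obtain ⟨φ, hφ⟩ := Module.le_rank_iff_exists_linearMap.1
    ((le_rank_iff_formGe hc hs j t₀).2 (h t₀ htL))
  refine ⟨(Submodule.subtype _).comp φ, Subtype.val_injective.comp hφ, fun c => ?_⟩
  set x : H := ((Submodule.subtype _).comp φ) c
  have hx : x ∈ upperSpan (S : H →ₗ[ℂ] H) t₀ := (φ c).2
  have htend : Tendsto (fun t : ℝ => t * ‖x‖ ^ 2) (nhdsWithin L (Set.Iio L))
      (nhds (L * ‖x‖ ^ 2)) :=
    ((continuous_id.mul continuous_const).tendsto L).mono_left nhdsWithin_le_nhds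
  refine le_of_tendsto htend ?_
  have hev : ∀ᶠ t in nhdsWithin L (Set.Iio L), t₀ < t :=
    nhdsWithin_le_nhds (lt_mem_nhds htL)
  filter_upwards [hev, self_mem_nhdsWithin] with t h1 h2
  refine form_ge_of_mem hc hs ?_
  rw [heq t h1.le h2]
  exact hx

end Abstract

lemma isJthPosEig_conj {V V' : Type} [AddCommGroup V] [Module ℂ V] [AddCommGroup V'] [Module ℂ V']
    (e : V ≃ₗ[ℂ] V') (S : V →ₗ[ℂ] V) (S' : V' →ₗ[ℂ] V') (h : ∀ x, S' (e x) = e (S x))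
    (j : ℕ) (L : ℝ) : IsJthPosEig S j L ↔ IsJthPosEig S' j L := by
  have key : ∀ t, Module.rank ℂ (upperSpan S t) = Module.rank ℂ (upperSpan S' t) := by
    intro t
    have h1 : upperSpan S' t = (upperSpan S t).map (e : V →ₗ[ℂ] V') := by
      unfold upperSpan
      rw [Submodule.map_iSup]
      congr 1
      funext s
      ext y
      rw [Submodule.mem_map]
      constructor
      · intro hy
        refine ⟨e.symm y, ?_, by simp⟩
        rw [Module.End.mem_eigenspace_iff] at hy ⊢
        apply e.injective
        rw [← h, map_smul]
        simpa using hy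
      · rintro ⟨x, hx, rfl⟩
        rw [Module.End.mem_eigenspace_iff] at hx ⊢
        change S' (e x) = _
        rw [h, hx, map_smul]
        rfl
    rw [h1]
    exact (e.rank_map_eq (upperSpan S t)).symm
  have e1 := key L
  have e2 : ∀ t, Module.rank ℂ _ = Module.rank ℂ _ := key
  unfold upperSpan at e1 e2
  unfold IsJthPosEig
  simp only [e2]

lemma isJthNegEig_iff_neg {V : Type*} [AddCommGroup V] [Module ℂ V]
    (S : V →ₗ[ℂ] V) (j : ℕ) (L : ℝ) : IsJthNegEig S j L ↔ IsJthPosEig (-S) j (-L) := by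
  have key : ∀ t : ℝ, (⨆ s : {s : ℝ // s ≤ t}, Module.End.eigenspace S ((s : ℝ) : ℂ))
      = ⨆ s : {s : ℝ // -t ≤ s}, Module.End.eigenspace (-S) ((s : ℝ) : ℂ) := by
    intro t
    apply le_antisymm
    · refine iSup_le fun s => ?_
      refine le_trans ?_ (le_iSup _ (⟨-s.1, neg_le_neg s.2⟩ : {s : ℝ // -t ≤ s}))
      intro x hx
      rw [Module.End.mem_eigenspace_iff] at hx ⊢
      simp [hx]
    · refine iSup_le fun s => ?_
      refine le_trans ?_ (le_iSup _ (⟨-s.1, neg_le.1 s.2⟩ : {s : ℝ // s ≤ t}))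
      intro x hx
      rw [Module.End.mem_eigenspace_iff] at hx ⊢
      rw [LinearMap.neg_apply, neg_eq_iff_eq_neg] at hx
      simp [hx]
  unfold IsJthNegEig IsJthPosEig
  have key2 : ∀ t : ℝ,
      Module.rank ℂ ↥(⨆ s : {s : ℝ // s ≤ t}, Module.End.eigenspace S ((s : ℝ) : ℂ))
      = Module.rank ℂ ↥(⨆ s : {s : ℝ // -t ≤ s}, Module.End.eigenspace (-S) ((s : ℝ) : ℂ)) :=
    fun t => by rw [key t]
  simp only [key2]
  constructor
  · rintro ⟨h1, h2, h3⟩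
    refine ⟨by linarith, h2, fun t ht => ?_⟩
    have := h3 (-t) (by linarith)
    rwa [neg_neg] at this
  · rintro ⟨h1, h2, h3⟩
    exact ⟨by linarith, h2, fun t ht => h3 (-t) (by linarith)⟩

section Concrete

/-- The sequence space. -/
noncomputable abbrev Ell := lp (fun _ : ℕ => ℂ) 2

/-- Restriction to the first `N` coordinates. -/
noncomputable def resN (N : ℕ) : Ell →L[ℂ] EuclideanSpace ℂ (Fin N) :=
  ((PiLp.continuousLinearEquiv 2 ℂ (fun _ : Fin N => ℂ)).symm :
      (Fin N → ℂ) →L[ℂ] EuclideanSpace ℂ (Fin N)).comp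
    (ContinuousLinearMap.pi fun k : Fin N => lp.evalCLM ℂ (fun _ : ℕ => ℂ) 2 (k : ℕ))

lemma resN_apply (N : ℕ) (x : Ell) (k : Fin N) : resN N x k = x k := rfl

/-- Extension by zero. -/
noncomputable def extN (N : ℕ) : EuclideanSpace ℂ (Fin N) →L[ℂ] Ell :=
  ContinuousLinearMap.adjoint (resN N)

lemma inner_extN (N : ℕ) (y : EuclideanSpace ℂ (Fin N)) (x : Ell) :
    ⟪extN N y, x⟫_ℂ = ⟪y, resN N x⟫_ℂ := ContinuousLinearMap.adjoint_inner_left _ _ _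

lemma coord_eq (x : Ell) (n : ℕ) : x n = ⟪lp.single 2 n (1 : ℂ), x⟫_ℂ := by
  rw [lp.inner_single_left]; simp

lemma extN_apply (N : ℕ) (y : EuclideanSpace ℂ (Fin N)) (n : ℕ) :
    extN N y n = if h : n < N then y ⟨n, h⟩ else 0 := by
  have h1 : (extN N y) n = ⟪resN N (lp.single 2 n (1 : ℂ)), y⟫_ℂ := by
    rw [coord_eq]; exact ContinuousLinearMap.adjoint_inner_right _ _ _
  rw [h1, PiLp.inner_apply]
  simp only [resN_apply]
  split_ifs with h
  · rw [Finset.sum_eq_single ⟨n, h⟩]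
    · simp
    · intro k _ hk
      have : (k : ℕ) ≠ n := fun h' => hk (Fin.ext h')
      simp [this]
    · simp
  · refine Finset.sum_eq_zero fun k _ => ?_
    have : (k : ℕ) ≠ n := by have := k.2; omega
    simp [this]

lemma resN_extN (N : ℕ) (y : EuclideanSpace ℂ (Fin N)) : resN N (extN N y) = y := by
  ext k
  rw [resN_apply, extN_apply, dif_pos k.2]

lemma norm_extN (N : ℕ) (y : EuclideanSpace ℂ (Fin N)) : ‖extN N y‖ = ‖y‖ := by
  have h : ‖extN N y‖ ^ 2 = ‖y‖ ^ 2 := by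
    rw [← inner_self_eq_norm_sq (𝕜 := ℂ), ← inner_self_eq_norm_sq (𝕜 := ℂ), inner_extN, resN_extN]
  exact (sq_eq_sq₀ (norm_nonneg _) (norm_nonneg _)).1 h

lemma extN_resN_apply (N : ℕ) (x : Ell) (n : ℕ) :
    extN N (resN N x) n = if n < N then x n else 0 := by
  rw [extN_apply]
  split_ifs <;> rfl

lemma extN_resN_of_supp (N : ℕ) (x : Ell) (hx : ∀ n, N ≤ n → x n = 0) :
    extN N (resN N x) = x := by
  ext n
  rw [extN_resN_apply]
  split_ifs with h
  · rfl
  · exact (hx n (not_lt.1 h)).symm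

lemma norm_resN_le (N : ℕ) (x : Ell) : ‖resN N x‖ ≤ ‖x‖ := by
  have h : ‖resN N x‖ ^ 2 ≤ ‖resN N x‖ * ‖x‖ := by
    rw [← inner_self_eq_norm_sq (𝕜 := ℂ), ← inner_extN]
    calc RCLike.re ⟪extN N (resN N x), x⟫_ℂ ≤ ‖extN N (resN N x)‖ * ‖x‖ :=
          re_inner_le_norm _ _
      _ = _ := by rw [norm_extN]
  by_cases h0 : ‖resN N x‖ = 0
  · rw [h0]; exact norm_nonneg _
  · have : 0 < ‖resN N x‖ := lt_of_le_of_ne (norm_nonneg _) (Ne.symm h0)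
    nlinarith

lemma ell_norm_sq (x : Ell) : HasSum (fun n => ‖x n‖ ^ 2) (‖x‖ ^ 2) := by
  have := lp.hasSum_norm (p := 2) (by norm_num) x
  simpa using this

/-- Hilbert–Schmidt bound. -/
lemma hs_bound (g : ℕ → ℕ → ℂ) (hsq : Summable fun p : ℕ × ℕ => ‖g p.1 p.2‖ ^ 2)
    (x y : Ell) (hy : ∀ n, y n = ∑' m, g n m * x m) :
    ‖y‖ ^ 2 ≤ (∑' p : ℕ × ℕ, ‖g p.1 p.2‖ ^ 2) * ‖x‖ ^ 2 := by
  have hrow : ∀ n, Summable fun m => ‖g n m‖ ^ 2 := fun n => hsq.prod_factor n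
  have hb : ∀ n, ‖y n‖ ^ 2 ≤ (∑' m, ‖g n m‖ ^ 2) * ‖x‖ ^ 2 := by
    intro n
    have hm : Memℓp (fun m => (starRingEnd ℂ) (g n m)) 2 := by
      rw [memℓp_gen_iff (by norm_num)]
      simpa using hrow n
    let r : Ell := ⟨_, hm⟩
    have h1 : y n = ⟪r, x⟫_ℂ := by
      rw [hy, lp.inner_eq_tsum]
      refine tsum_congr fun m => ?_
      simp [r, mul_comm]
    have h2 : ‖r‖ ^ 2 = ∑' m, ‖g n m‖ ^ 2 := by
      rw [← (ell_norm_sq r).tsum_eq]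
      refine tsum_congr fun m => ?_
      simp [r]
    rw [← h2, h1, ← mul_pow]
    gcongr
    exact norm_inner_le_norm _ _
  have hs2 : Summable fun n => ∑' m, ‖g n m‖ ^ 2 := hsq.prod
  rw [← (ell_norm_sq y).tsum_eq, hsq.tsum_prod, ← tsum_mul_right]
  exact (ell_norm_sq y).summable.tsum_le_tsum hb (hs2.mul_right _)

variable {f : ℕ → ℕ → ℂ}
  {T : Ell →L[ℂ] Ell}

lemma row_summable (hsq : Summable fun p : ℕ × ℕ => ‖f p.1 p.2‖ ^ 2) (x : Ell) (n : ℕ) :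
    Summable fun m => f n m * x m := by
  have hm : Memℓp (fun m => (starRingEnd ℂ) (f n m)) 2 := by
    rw [memℓp_gen_iff (by norm_num)]
    simpa using hsq.prod_factor n
  have := lp.summable_inner (𝕜 := ℂ) (⟨_, hm⟩ : Ell) x
  refine this.congr fun m => ?_
  simp [mul_comm]

lemma T_symm (hherm : ∀ n m, (starRingEnd ℂ) (f n m) = f m n)
    (hT : ∀ (x : Ell) (n : ℕ), T x n = ∑' m, f n m * x m) :
    (T : Ell →ₗ[ℂ] Ell).IsSymmetric := by
  have hcol : ∀ n m, T (lp.single 2 n (1 : ℂ)) m = f m n := by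
    intro n m
    rw [hT, tsum_eq_single n]
    · simp
    · intro k hk
      simp [hk]
  have hadj : ContinuousLinearMap.adjoint T = T := by
    ext y n
    rw [coord_eq, ContinuousLinearMap.adjoint_inner_right, lp.inner_eq_tsum, hT]
    refine tsum_congr fun m => ?_
    rw [hcol]
    simp [hherm, mul_comm]
  intro x y
  have := ContinuousLinearMap.adjoint_inner_left T y x
  rw [hadj] at this
  exact this

/-- The compressed operator. -/
noncomputable def compr (T : Ell →L[ℂ] Ell) (N : ℕ) :
    EuclideanSpace ℂ (Fin N) →L[ℂ] EuclideanSpace ℂ (Fin N) :=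
  (resN N).comp (T.comp (extN N))

/-- The truncated operator on the whole space. -/
noncomputable def trunc (T : Ell →L[ℂ] Ell) (N : ℕ) : Ell →L[ℂ] Ell :=
  (extN N).comp ((compr T N).comp (resN N))

lemma compr_symm (hs : (T : Ell →ₗ[ℂ] Ell).IsSymmetric) (N : ℕ) :
    (compr T N : EuclideanSpace ℂ (Fin N) →ₗ[ℂ] EuclideanSpace ℂ (Fin N)).IsSymmetric := by
  intro x y
  change ⟪resN N (T (extN N x)), y⟫_ℂ = ⟪x, resN N (T (extN N y))⟫_ℂ
  rw [← inner_extN, ← inner_conj_symm, ← inner_extN, inner_conj_symm]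
  exact hs _ _

lemma compr_compact (T : Ell →L[ℂ] Ell) (N : ℕ) : IsCompactOperator (compr T N) :=
  isCompactOperator_of_locallyCompactSpace_dom _

lemma compr_form (T : Ell →L[ℂ] Ell) (N : ℕ) (y : EuclideanSpace ℂ (Fin N)) :
    ⟪compr T N y, y⟫_ℂ = ⟪T (extN N y), extN N y⟫_ℂ := by
  change ⟪resN N (T (extN N y)), y⟫_ℂ = _
  rw [← inner_conj_symm, ← inner_extN, inner_conj_symm]

lemma trunc_bound (hsq : Summable fun p : ℕ × ℕ => ‖f p.1 p.2‖ ^ 2)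
    (hT : ∀ (x : Ell) (n : ℕ), T x n = ∑' m, f n m * x m) (N : ℕ) (x : Ell) :
    ‖(T - trunc T N) x‖ ^ 2 ≤
      (∑' p : {p : ℕ × ℕ // p ∉ Finset.range N ×ˢ Finset.range N}, ‖f p.1.1 p.1.2‖ ^ 2)
        * ‖x‖ ^ 2 := by
  set g : ℕ → ℕ → ℂ := fun n m => if n < N ∧ m < N then 0 else f n m with hg
  have hind : (fun p : ℕ × ℕ => ‖g p.1 p.2‖ ^ 2) =
      Set.indicator {p | p ∉ Finset.range N ×ˢ Finset.range N}
        (fun p : ℕ × ℕ => ‖f p.1 p.2‖ ^ 2) := by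
    funext p
    simp only [hg, Set.indicator, Set.mem_ofPred_eq, Finset.mem_product, Finset.mem_range]
    by_cases h : p.1 < N ∧ p.2 < N <;> simp [h]
  have hgs : Summable fun p : ℕ × ℕ => ‖g p.1 p.2‖ ^ 2 := by
    rw [hind]; exact hsq.indicator _
  have hb := hs_bound g hgs x ((T - trunc T N) x) ?_
  · rw [hind, ← tsum_subtype] at hb
    exact hb
  · intro n
    change T x n - trunc T N x n = _
    have h1 : trunc T N x n = if n < N then ∑' m, f n m * extN N (resN N x) m else 0 := by
      change extN N (resN N (T (extN N (resN N x)))) n = _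
      rw [extN_resN_apply, hT]
    rw [h1, hT]
    by_cases hn : n < N
    · rw [if_pos hn, ← (row_summable hsq x n).tsum_sub (row_summable hsq _ n)]
      refine tsum_congr fun m => ?_
      rw [extN_resN_apply]
      by_cases hm : m < N <;> simp [hg, hn, hm]
    · rw [if_neg hn, sub_zero]
      refine tsum_congr fun m => ?_
      simp [hg, hn]

lemma trunc_tendsto (hsq : Summable fun p : ℕ × ℕ => ‖f p.1 p.2‖ ^ 2)
    (hT : ∀ (x : Ell) (n : ℕ), T x n = ∑' m, f n m * x m) {ε : ℝ} (hε : 0 < ε) :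
    ∃ N₁, ∀ N, N₁ ≤ N → ‖T - trunc T N‖ ≤ ε := by
  have h1 := tendsto_tsum_compl_atTop_zero (fun p : ℕ × ℕ => ‖f p.1 p.2‖ ^ 2)
  have h2 : Tendsto (fun N : ℕ => Finset.range N ×ˢ Finset.range N) atTop atTop := by
    refine tendsto_atTop_finset_of_monotone ?_ ?_
    · intro a b hab
      exact Finset.product_subset_product (Finset.range_mono hab) (Finset.range_mono hab)
    · intro p
      refine ⟨p.1 + p.2 + 1, ?_⟩
      simp only [Finset.mem_product, Finset.mem_range]
      omega
  have h3 := (h1.comp h2).eventually (gt_mem_nhds (show (0 : ℝ) < ε ^ 2 by positivity))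
  obtain ⟨N₁, hN₁⟩ := eventually_atTop.1 h3
  refine ⟨N₁, fun N hN => ContinuousLinearMap.opNorm_le_bound _ hε.le fun x => ?_⟩
  have h4 := trunc_bound hsq hT N x
  have h5 : ‖(T - trunc T N) x‖ ^ 2 ≤ (ε * ‖x‖) ^ 2 := by
    refine h4.trans ?_
    rw [mul_pow]
    exact mul_le_mul_of_nonneg_right (hN₁ N hN).le (by positivity)
  exact (sq_le_sq₀ (norm_nonneg _) (by positivity)).1 h5

lemma T_compact (hsq : Summable fun p : ℕ × ℕ => ‖f p.1 p.2‖ ^ 2)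
    (hT : ∀ (x : Ell) (n : ℕ), T x n = ∑' m, f n m * x m) : IsCompactOperator T := by
  refine isCompactOperator_of_tendsto (l := atTop) (F := fun N => trunc T N) ?_ ?_
  · rw [Metric.tendsto_atTop]
    intro ε hε
    obtain ⟨N₁, h⟩ := trunc_tendsto hsq hT (half_pos hε)
    refine ⟨N₁, fun N hN => ?_⟩
    rw [dist_comm, dist_eq_norm]
    linarith [h N hN]
  · refine Eventually.of_forall fun N => ?_
    exact ((compr_compact T N).comp_clm (resN N)).clm_comp (extN N)

lemma form_approx {N : ℕ} {ε : ℝ} (h : ‖T - trunc T N‖ ≤ ε) (x : Ell) :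
    (⟪T x, x⟫_ℂ).re - ε * ‖x‖ ^ 2 ≤ (⟪compr T N (resN N x), resN N x⟫_ℂ).re := by
  have h1 : ⟪compr T N (resN N x), resN N x⟫_ℂ = ⟪trunc T N x, x⟫_ℂ := by
    rw [← inner_extN]; rfl
  have h2 : ⟪T x, x⟫_ℂ - ⟪trunc T N x, x⟫_ℂ = ⟪(T - trunc T N) x, x⟫_ℂ := by
    rw [← inner_sub_left]; rfl
  have h3 : (⟪(T - trunc T N) x, x⟫_ℂ).re ≤ ε * ‖x‖ ^ 2 := by
    calc _ ≤ ‖(T - trunc T N) x‖ * ‖x‖ := re_inner_le_norm (𝕜 := ℂ) _ _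
      _ ≤ ‖T - trunc T N‖ * ‖x‖ * ‖x‖ := by gcongr; exact ContinuousLinearMap.le_opNorm _ _
      _ ≤ ε * ‖x‖ * ‖x‖ := by gcongr
      _ = _ := by ring
  rw [h1]
  have h4 := congrArg Complex.re h2
  rw [Complex.sub_re] at h4
  linarith

lemma formGe_compr_of {j N : ℕ} {ε t : ℝ} (h : ‖T - trunc T N‖ ≤ ε) (ht : ε < t)
    (hF : FormGe T j t) : FormGe (compr T N) j (t - ε) := by
  obtain ⟨φ, h1, h2⟩ := hF
  have key : ∀ c, (t - ε) * ‖φ c‖ ^ 2 ≤ (⟪compr T N (resN N (φ c)), resN N (φ c)⟫_ℂ).re := by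
    intro c
    have := form_approx h (φ c)
    have := h2 c
    linarith
  refine ⟨(resN N : Ell →ₗ[ℂ] _).comp φ, ?_, fun c => ?_⟩
  · rw [← LinearMap.ker_eq_bot, LinearMap.ker_eq_bot']
    intro c hc
    have hc' : resN N (φ c) = 0 := hc
    have h3 := key c
    rw [hc'] at h3
    simp only [map_zero, inner_zero_left, Complex.zero_re] at h3
    have h4 : ‖φ c‖ ^ 2 ≤ 0 := by
      by_contra hlt
      push Not at hlt
      nlinarith [mul_pos (sub_pos.2 ht) hlt]
    have h5 : φ c = 0 := by
      have : ‖φ c‖ ^ 2 = 0 := le_antisymm h4 (by positivity)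
      simpa using this
    exact h1 (h5.trans (map_zero φ).symm)
  · refine le_trans ?_ (key c)
    refine mul_le_mul_of_nonneg_left ?_ (by linarith)
    have := norm_resN_le N (φ c)
    change ‖resN N (φ c)‖ ^ 2 ≤ _
    gcongr

lemma formGe_of_compr {j N : ℕ} {t : ℝ} (hF : FormGe (compr T N) j t) : FormGe T j t := by
  obtain ⟨φ, h1, h2⟩ := hF
  refine ⟨(extN N : _ →ₗ[ℂ] Ell).comp φ, ?_, fun c => ?_⟩
  · exact (Function.LeftInverse.injective (resN_extN N)).comp h1
  · change t * ‖extN N (φ c)‖ ^ 2 ≤ (⟪T (extN N (φ c)), extN N (φ c)⟫_ℂ).re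
    rw [norm_extN, ← compr_form]
    exact h2 c

lemma formGe_compr_mono {j N M : ℕ} {t : ℝ} (hNM : N ≤ M) (hF : FormGe (compr T N) j t) :
    FormGe (compr T M) j t := by
  obtain ⟨φ, h1, h2⟩ := hF
  have hsup : ∀ y, extN M (resN M (extN N y)) = extN N y := fun y => by
    refine extN_resN_of_supp _ _ fun n hn => ?_
    rw [extN_apply, dif_neg (by omega)]
  refine ⟨((resN M).comp (extN N) : _ →ₗ[ℂ] EuclideanSpace ℂ (Fin M)).comp φ, ?_, fun c => ?_⟩
  · have hinj : Function.Injective fun y => resN M (extN N y) := by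
      intro y y' h
      have h' := congrArg (extN M) h
      simp only [hsup] at h'
      exact (Function.LeftInverse.injective (resN_extN N)) h'
    exact hinj.comp h1
  · change t * ‖resN M (extN N (φ c))‖ ^ 2 ≤
      (⟪compr T M (resN M (extN N (φ c))), resN M (extN N (φ c))⟫_ℂ).re
    rw [compr_form, hsup, ← norm_extN M, hsup, norm_extN, ← compr_form]
    exact h2 c

lemma matrix_iff (hherm : ∀ n m, (starRingEnd ℂ) (f n m) = f m n)
    (hT : ∀ (x : Ell) (n : ℕ), T x n = ∑' m, f n m * x m) (N j : ℕ) (a : ℝ) :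
    IsJthPosEig (Matrix.toLin' (Matrix.of fun i k : Fin N => f i k)) j a ↔
      0 < a ∧ FormGe (compr T N) j a ∧ ∀ t, a < t → ¬ FormGe (compr T N) j t := by
  rw [← isJthPosEig_iff (compr_compact T N) (compr_symm (T_symm hherm hT) N)]
  refine isJthPosEig_conj (WithLp.linearEquiv 2 ℂ (Fin N → ℂ)).symm _ _ (fun x => ?_) j a
  ext i
  change T (extN N (WithLp.toLp 2 x)) i = (Matrix.toLin' (Matrix.of fun i k : Fin N => f i k)) x i
  rw [hT, Matrix.toLin'_apply, Matrix.mulVec, dotProduct,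
    tsum_eq_sum (s := Finset.range N), Finset.sum_range]
  · refine Finset.sum_congr rfl fun k _ => ?_
    rw [extN_apply, dif_pos k.2]
    rfl
  · intro m hm
    rw [Finset.mem_range] at hm
    rw [extN_apply, dif_neg hm, mul_zero]

lemma pos_part (hherm : ∀ n m, (starRingEnd ℂ) (f n m) = f m n)
    (hsq : Summable fun p : ℕ × ℕ => ‖f p.1 p.2‖ ^ 2)
    (hT : ∀ (x : Ell) (n : ℕ), T x n = ∑' m, f n m * x m)
    (j : ℕ) (hj : 1 ≤ j) (N₀ : ℕ) (a₀ : ℝ)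
    (h0 : IsJthPosEig (Matrix.toLin' (Matrix.of fun i k : Fin N₀ => f i k)) j a₀) :
      ∃ L : ℝ,
        IsJthPosEig (T : Ell →ₗ[ℂ] Ell) j L ∧
        (∀ (N : ℕ) (a : ℝ),
          IsJthPosEig (Matrix.toLin' (Matrix.of fun i k : Fin N => f i k)) j a → a ≤ L) ∧
        (∀ μ : ℕ → ℝ,
          (∀ N, N₀ ≤ N →
            IsJthPosEig (Matrix.toLin' (Matrix.of fun i k : Fin N => f i k)) j (μ N)) →
          MonotoneOn μ (Set.Ici N₀) ∧ Tendsto μ atTop (nhds L)) := by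
  have hs := T_symm hherm hT
  have hc := T_compact hsq hT
  simp only [matrix_iff hherm hT] at h0 ⊢
  rw [funext fun L => propext (isJthPosEig_iff hc hs j L)]
  obtain ⟨ha0, hF0, -⟩ := h0
  set A : Set ℝ := {t | FormGe T j t} with hA
  have hbdd : BddAbove A := ⟨‖T‖, fun t ht => FormGe.le_norm hj ht⟩
  have ha₀ : a₀ ∈ A := formGe_of_compr hF0
  set L := sSup A with hL
  have haL : a₀ ≤ L := le_csSup hbdd ha₀
  have hLpos : 0 < L := ha0.trans_le haL
  have hlt : ∀ t, t < L → FormGe T j t := by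
    intro t ht
    obtain ⟨s, hs1, hs2⟩ := exists_lt_of_lt_csSup ⟨a₀, ha₀⟩ ht
    exact FormGe.mono hs1 hs2.le
  have hFL : FormGe T j L := by
    obtain ⟨N, hN⟩ := trunc_tendsto hsq hT (show 0 < L / 4 by linarith)
    refine formGe_sup (N := N) (a := L / 2) hc hs (by linarith) ?_ hlt
    intro hF
    obtain ⟨φ, hφ, -⟩ := formGe_compr_of (hN N le_rfl) (by linarith) hF
    have := LinearMap.finrank_le_finrank_of_injective hφ
    simp at this
  refine ⟨L, ⟨hLpos, hFL, fun t ht hF => ?_⟩, ?_, ?_⟩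
  · exact absurd (le_csSup hbdd hF) (not_le.2 ht)
  · rintro N a ⟨_, h, _⟩
    exact le_csSup hbdd (formGe_of_compr h)
  · intro μ hμ
    refine ⟨?_, ?_⟩
    · intro N hN M hM hNM
      by_contra hlt'
      push Not at hlt'
      exact (hμ M hM).2.2 _ hlt' (formGe_compr_mono hNM (hμ N hN).2.1)
    · rw [Metric.tendsto_atTop]
      intro ε hε
      set δ := min (ε / 2) (L / 2) with hδ
      have hδ0 : 0 < δ := lt_min (by linarith) (by linarith)
      have hδ1 : δ ≤ ε / 2 := min_le_left _ _
      have hδ2 : δ ≤ L / 2 := min_le_right _ _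
      obtain ⟨N₁, hN₁⟩ := trunc_tendsto hsq hT hδ0
      refine ⟨max N₀ N₁, fun N hN => ?_⟩
      obtain ⟨_, h2, h3⟩ := hμ N ((le_max_left _ _).trans hN)
      have h4 := formGe_compr_of (hN₁ N ((le_max_right _ _).trans hN)) (by linarith) hFL
      have h5 : L - δ ≤ μ N := by
        by_contra hlt'
        push Not at hlt'
        exact h3 _ hlt' h4
      have h6 : μ N ≤ L := le_csSup hbdd (formGe_of_compr h2)
      rw [Real.dist_eq, abs_lt]
      constructor <;> linarith

end Concrete

/-- Let `𝔽 = (f_{n,m})` be Hermitian and square-summable, acting as the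
self-adjoint Hilbert–Schmidt operator `T` on `ℓ²(ℕ)`, with `N×N` truncations `𝔽^{(N)}`.
Fix `j ≥ 1`.  If some truncation has at least `j` positive eigenvalues, then `T` has a
`j`-th largest positive eigenvalue `μ_j` and the `j`-th truncated positive eigenvalues
increase monotonically to `μ_j`; symmetrically for the `j`-th negative eigenvalues. -/
theorem truncated_eigenvalues_converge
    (f : ℕ → ℕ → ℂ)
    (hherm : ∀ n m, (starRingEnd ℂ) (f n m) = f m n)
    (hsq : Summable fun p : ℕ × ℕ => ‖f p.1 p.2‖ ^ 2)
    (T : lp (fun _ : ℕ => ℂ) 2 →L[ℂ] lp (fun _ : ℕ => ℂ) 2)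
    (hT : ∀ (x : lp (fun _ : ℕ => ℂ) 2) (n : ℕ), T x n = ∑' m, f n m * x m)
    (j : ℕ) (hj : 1 ≤ j) :
    (∀ (N₀ : ℕ) (a₀ : ℝ),
      IsJthPosEig (Matrix.toLin' (Matrix.of fun i k : Fin N₀ => f i k)) j a₀ →
      ∃ L : ℝ,
        IsJthPosEig (T : lp (fun _ : ℕ => ℂ) 2 →ₗ[ℂ] lp (fun _ : ℕ => ℂ) 2) j L ∧
        (∀ (N : ℕ) (a : ℝ),
          IsJthPosEig (Matrix.toLin' (Matrix.of fun i k : Fin N => f i k)) j a → a ≤ L) ∧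
        (∀ μ : ℕ → ℝ,
          (∀ N, N₀ ≤ N →
            IsJthPosEig (Matrix.toLin' (Matrix.of fun i k : Fin N => f i k)) j (μ N)) →
          MonotoneOn μ (Set.Ici N₀) ∧ Tendsto μ atTop (nhds L))) ∧
    (∀ (N₀ : ℕ) (b₀ : ℝ),
      IsJthNegEig (Matrix.toLin' (Matrix.of fun i k : Fin N₀ => f i k)) j b₀ →
      ∃ L : ℝ,
        IsJthNegEig (T : lp (fun _ : ℕ => ℂ) 2 →ₗ[ℂ] lp (fun _ : ℕ => ℂ) 2) j L ∧
        (∀ (N : ℕ) (b : ℝ),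
          IsJthNegEig (Matrix.toLin' (Matrix.of fun i k : Fin N => f i k)) j b → L ≤ b) ∧
        (∀ μ : ℕ → ℝ,
          (∀ N, N₀ ≤ N →
            IsJthNegEig (Matrix.toLin' (Matrix.of fun i k : Fin N => f i k)) j (μ N)) →
          AntitoneOn μ (Set.Ici N₀) ∧ Tendsto μ atTop (nhds L))) := by
  refine ⟨fun N₀ a₀ h0 => pos_part hherm hsq hT j hj N₀ a₀ h0, fun N₀ b₀ h0 => ?_⟩
  have hmat : ∀ N : ℕ, -(Matrix.toLin' (Matrix.of fun i k : Fin N => f i k)) =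
      Matrix.toLin' (Matrix.of fun i k : Fin N => (fun n m => -f n m) i k) := by
    intro N
    rw [← map_neg]
    rfl
  simp only [isJthNegEig_iff_neg, hmat] at h0 ⊢
  obtain ⟨L, h1, h2, h3⟩ := pos_part (f := fun n m => -f n m) (T := -T)
    (fun n m => by rw [map_neg, hherm]) (by simpa using hsq)
    (fun x n => by
      change -(T x n) = _
      rw [hT, ← tsum_neg]
      exact tsum_congr fun m => by ring) j hj N₀ (-b₀) h0
  refine ⟨-L, ?_, fun N b hb => ?_, fun μ hμ => ?_⟩
  · rw [neg_neg]; exact h1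
  · have := h2 N _ hb
    linarith
  · obtain ⟨h4, h5⟩ := h3 (fun N => -μ N) hμ
    refine ⟨fun N hN M hM hNM => ?_, ?_⟩
    · have := h4 hN hM hNM
      simp only at this
      linarith
    · simpa using h5.neg
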